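/- Let G be a group with identity e and let F ≤ H ≤ G be subgroups satisfying property (P): for every finite subset S ⊆ G∖H there exists f ∈ F such that gfh ∉ F for all g, h ∈ S. Let M be a von Neumann algebra with faithful tracial state τ, and let u : G → U(M) be a group homomorphism into the unitary group of M with τ(u_g) = 0 for all g ≠ e and M = vN({u_g : g ∈ G}). Set L(F) := vN({u_f : f ∈ F}) and L(H) := vN({u_h : h ∈ H}), assume that every element of M (respectively of L(H), respectively of L(F)) can be approximated in ‖·‖₂ by finite linear combinations of {u_g : g ∈ G} (respectively {u_h : h ∈ H}, respectively {u_f : f ∈ F}), and assume the τ-preserving conditional expectations E_{L(F)} and E_{L(H)} exist. Then the triple L(F) ⊆ L(H) ⊆ M satisfies the relative weak asymptotic homomorphism property. -/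

import Mathlib

open scoped ComplexOrder

noncomputable section

variable {H : Type*} [NormedAddCommGroup H] [InnerProductSpace ℂ H] [CompleteSpace H]

/-- The von Neumann algebra generated by a set of bounded operators `S`:
the double commutant of `S ∪ S*`. -/
def vNgen (S : Set (H →L[ℂ] H)) : Set (H →L[ℂ] H) :=
  Set.centralizer (Set.centralizer (S ∪ star '' S))

/-- `M` is a von Neumann algebra acting on `H`: a unital *-subalgebra of `B(H)`
equal to its double commutant. -/
structure IsVonNeumannAlgebra (M : Set (H →L[ℂ] H)) : Prop where
  one_mem : (1 : H →L[ℂ] H) ∈ M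
  add_mem : ∀ x ∈ M, ∀ y ∈ M, x + y ∈ M
  mul_mem : ∀ x ∈ M, ∀ y ∈ M, x * y ∈ M
  smul_mem : ∀ (c : ℂ), ∀ x ∈ M, c • x ∈ M
  star_mem : ∀ x ∈ M, star x ∈ M
  double_commutant : Set.centralizer (Set.centralizer M) = M

/-- `τ` is a faithful tracial state on `M`. -/
structure IsFaithfulTracialState (M : Set (H →L[ℂ] H)) (τ : (H →L[ℂ] H) → ℂ) : Prop where
  map_add : ∀ x ∈ M, ∀ y ∈ M, τ (x + y) = τ x + τ y
  map_smul : ∀ (c : ℂ), ∀ x ∈ M, τ (c • x) = c * τ x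
  map_one : τ 1 = 1
  nonneg : ∀ x ∈ M, 0 ≤ τ (star x * x)
  tracial : ∀ x ∈ M, ∀ y ∈ M, τ (x * y) = τ (y * x)
  faithful : ∀ x ∈ M, τ (star x * x) = 0 → x = 0

/-- `M` is infinite dimensional: it is not contained in the span of finitely many operators. -/
def IsInfiniteDimensionalSet (M : Set (H →L[ℂ] H)) : Prop :=
  ∀ s : Finset (H →L[ℂ] H),
    ¬ (M ⊆ (Submodule.span ℂ (s : Set (H →L[ℂ] H)) : Set (H →L[ℂ] H)))

/-- `M` is a factor: its center consists of scalar multiples of the identity. -/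
def IsFactor (M : Set (H →L[ℂ] H)) : Prop :=
  ∀ x ∈ M, (∀ y ∈ M, x * y = y * x) → ∃ c : ℂ, x = c • (1 : H →L[ℂ] H)

/-- `M` is a II₁ factor with faithful tracial state `τ`. -/
structure IsII1Factor (M : Set (H →L[ℂ] H)) (τ : (H →L[ℂ] H) → ℂ) : Prop where
  vna : IsVonNeumannAlgebra M
  factor : IsFactor M
  infdim : IsInfiniteDimensionalSet M
  trace : IsFaithfulTracialState M τ

/-- The 2-norm `‖x‖₂ = τ(x*x)^{1/2}` associated to the trace `τ`. -/
def norm2 (τ : (H →L[ℂ] H) → ℂ) (x : H →L[ℂ] H) : ℝ :=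
  Real.sqrt (τ (star x * x)).re

/-- `E` is the `τ`-preserving conditional expectation of `M` onto `B`. -/
def IsCondExp (M B : Set (H →L[ℂ] H)) (τ : (H →L[ℂ] H) → ℂ)
    (E : (H →L[ℂ] H) → (H →L[ℂ] H)) : Prop :=
  (∀ x ∈ M, E x ∈ B) ∧ (∀ x ∈ M, ∀ b ∈ B, τ ((x - E x) * b) = 0)

/-- `A` is a maximal abelian *-subalgebra (MASA) of `M`. -/
def IsMasa (M A : Set (H →L[ℂ] H)) : Prop :=
  A ⊆ M ∧ (∀ a ∈ A, star a ∈ A) ∧ {x ∈ M | ∀ a ∈ A, x * a = a * x} = A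

/-- `u` is a unitary operator. -/
def IsUnitary (u : H →L[ℂ] H) : Prop :=
  star u * u = 1 ∧ u * star u = 1

/-- The set of normalizing unitaries of `A` in `M`: unitaries `u ∈ M` with `uAu* = A`. -/
def normalizerSet (M A : Set (H →L[ℂ] H)) : Set (H →L[ℂ] H) :=
  {u | u ∈ M ∧ IsUnitary u ∧ (fun a => u * a * star u) '' A = A}

/-- The normalizing algebra `N_M(A)''` of `A` in `M`. -/
def normAlg (M A : Set (H →L[ℂ] H)) : Set (H →L[ℂ] H) :=
  vNgen (normalizerSet M A)

/-- The triple `B ⊆ N ⊆ M` satisfies the relative weak asymptotic homomorphism property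
relative to the trace `τ` and the conditional expectations `EB` and `EN`. -/
def RelWAHP (M N B : Set (H →L[ℂ] H)) (τ : (H →L[ℂ] H) → ℂ)
    (EB EN : (H →L[ℂ] H) → (H →L[ℂ] H)) : Prop :=
  ∀ (n : ℕ) (x : Fin n → (H →L[ℂ] H)), (∀ i, x i ∈ M) →
    ∀ ε : ℝ, 0 < ε → ∃ u ∈ B, IsUnitary u ∧
      ∀ i j, norm2 τ (EB (x i * u * x j) - EB (EN (x i) * u * EN (x j))) < ε

namespace IsFaithfulTracialState

variable {A : StarSubalgebra ℂ (H →L[ℂ] H)} {τ : (H →L[ℂ] H) → ℂ} {x y z : H →L[ℂ] H}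

lemma map_zero (hτ : IsFaithfulTracialState (A : Set (H →L[ℂ] H)) τ) : τ 0 = 0 := by
  simpa using hτ.map_smul 0 0 (zero_mem A)

lemma map_sub (hτ : IsFaithfulTracialState (A : Set (H →L[ℂ] H)) τ) (hx : x ∈ A) (hy : y ∈ A) :
    τ (x - y) = τ x - τ y := by
  have h := hτ.map_add (x - y) (sub_mem hx hy) y hy
  rw [sub_add_cancel] at h
  rw [h, add_sub_cancel_right]

lemma star_mul_im (hτ : IsFaithfulTracialState (A : Set (H →L[ℂ] H)) τ) (hx : x ∈ A) :
    (τ (star x * x)).im = 0 :=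
  ((Complex.nonneg_iff.1 (hτ.nonneg x hx)).2).symm

lemma conj_star_mul (hτ : IsFaithfulTracialState (A : Set (H →L[ℂ] H)) τ)
    (hx : x ∈ A) (hy : y ∈ A) : (starRingEnd ℂ) (τ (star y * x)) = τ (star x * y) := by
  have key : ∀ w ∈ A, (τ (star x * w)).im + (τ (star w * x)).im = 0 := by
    intro w hw
    have e : star (x + w) * (x + w) =
        (star x * x + star w * w) + (star x * w + star w * x) := by
      rw [star_add]; noncomm_ring
    have hxx := mul_mem (star_mem hx) hx
    have hww := mul_mem (star_mem hw) hw
    have hxw := mul_mem (star_mem hx) hw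
    have hwx := mul_mem (star_mem hw) hx
    have h := hτ.star_mul_im (add_mem hx hw)
    rw [e, hτ.map_add _ (add_mem hxx hww) _ (add_mem hxw hwx), hτ.map_add _ hxx _ hww,
      hτ.map_add _ hxw _ hwx] at h
    simpa [hτ.star_mul_im hx, hτ.star_mul_im hw] using h
  have h1 := key y hy
  have h2 := key (Complex.I • y) (A.smul_mem hy _)
  rw [star_smul, mul_smul_comm, smul_mul_assoc,
    hτ.map_smul _ _ (mul_mem (star_mem hx) hy), hτ.map_smul _ _ (mul_mem (star_mem hy) hx)] at h2
  apply Complex.ext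
  · simp at h2 ⊢; linarith
  · simp; linarith

/-- The positive semidefinite form `⟪x, y⟫ = τ (x* y)`. -/
@[reducible]
def preInner (hτ : IsFaithfulTracialState (A : Set (H →L[ℂ] H)) τ) :
    PreInnerProductSpace.Core ℂ A where
  inner x y := τ (star (x : H →L[ℂ] H) * (y : H →L[ℂ] H))
  conj_inner_symm x y := hτ.conj_star_mul x.2 y.2
  re_inner_nonneg x := (Complex.nonneg_iff.1 (hτ.nonneg x x.2)).1
  add_left x y z := by
    change τ (star ((x : H →L[ℂ] H) + y) * z) = _
    rw [star_add, add_mul, hτ.map_add _ (mul_mem (star_mem x.2) z.2) _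
      (mul_mem (star_mem y.2) z.2)]
  smul_left x y r := by
    change τ (star (r • (x : H →L[ℂ] H)) * y) = _
    rw [star_smul, smul_mul_assoc, hτ.map_smul _ _ (mul_mem (star_mem x.2) y.2)]
    rfl

lemma norm_le_norm2_mul_norm2 (hτ : IsFaithfulTracialState (A : Set (H →L[ℂ] H)) τ)
    (hx : x ∈ A) (hy : y ∈ A) : ‖τ (star x * y)‖ ≤ norm2 τ x * norm2 τ y :=
  @InnerProductSpace.Core.norm_inner_le_norm ℂ A _ _ _ hτ.preInner ⟨x, hx⟩ ⟨y, hy⟩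

lemma norm2_add_le (hτ : IsFaithfulTracialState (A : Set (H →L[ℂ] H)) τ)
    (hx : x ∈ A) (hy : y ∈ A) : norm2 τ (x + y) ≤ norm2 τ x + norm2 τ y :=
  @norm_add_le A (@InnerProductSpace.Core.toSeminormedAddCommGroup ℂ A _ _ _
    hτ.preInner).toSeminormedAddGroup ⟨x, hx⟩ ⟨y, hy⟩

lemma norm2_sq (hτ : IsFaithfulTracialState (A : Set (H →L[ℂ] H)) τ) (hx : x ∈ A) :
    ((norm2 τ x ^ 2 : ℝ) : ℂ) = τ (star x * x) := by
  have h := Complex.nonneg_iff.1 (hτ.nonneg x hx)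
  rw [norm2, Real.sq_sqrt h.1]
  apply Complex.ext <;> simp [hτ.star_mul_im hx]

lemma norm2_star (hτ : IsFaithfulTracialState (A : Set (H →L[ℂ] H)) τ) (hx : x ∈ A) :
    norm2 τ (star x) = norm2 τ x := by
  rw [norm2, norm2, star_star, hτ.tracial _ hx _ (star_mem hx)]

/-- The nonnegative operator `‖x‖² - x* x` has a square root in any double commutant containing
`x`. -/
lemma _root_.exists_star_mul_self_eq_norm_sq_sub
    (hA : Set.centralizer (Set.centralizer (A : Set (H →L[ℂ] H))) = A) (hx : x ∈ A) :
    ∃ r ∈ A, star r * r = ((‖x‖ ^ 2 : ℝ) : ℂ) • (1 : H →L[ℂ] H) - star x * x := by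
  set p : H →L[ℂ] H := ((‖x‖ ^ 2 : ℝ) : ℂ) • (1 : H →L[ℂ] H) - star x * x with hp
  have hp0 : 0 ≤ p := by
    have h := CStarAlgebra.star_mul_le_algebraMap_norm_sq (a := x)
    rw [Algebra.algebraMap_eq_smul_one] at h
    rw [hp, sub_nonneg]
    convert h using 1
    exact RCLike.real_smul_eq_coe_smul (K := ℂ) (‖x‖ ^ 2) (1 : H →L[ℂ] H) |>.symm
  have hpA : p ∈ A := sub_mem (A.smul_mem (one_mem A) _) (mul_mem (star_mem hx) hx)
  refine ⟨CFC.sqrt p, ?_, ?_⟩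
  · have : CFC.sqrt p ∈ Set.centralizer (Set.centralizer (A : Set (H →L[ℂ] H))) := by
      intro y hy
      have hc : Commute p y := hy p hpA
      rw [CFC.sqrt_eq_cfc]
      exact (hc.cfc_nnreal _).symm.eq
    rwa [hA] at this
  · rw [(IsSelfAdjoint.of_nonneg (CFC.sqrt_nonneg p)).star_eq, CFC.sqrt_mul_sqrt_self p hp0]

lemma norm2_mul_le (hτ : IsFaithfulTracialState (A : Set (H →L[ℂ] H)) τ)
    (hA : Set.centralizer (Set.centralizer (A : Set (H →L[ℂ] H))) = A)
    (hx : x ∈ A) (hy : y ∈ A) : norm2 τ (x * y) ≤ ‖x‖ * norm2 τ y := by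
  obtain ⟨r, hr, hrx⟩ := exists_star_mul_self_eq_norm_sq_sub hA hx
  have h := (Complex.nonneg_iff.1 (hτ.nonneg (r * y) (mul_mem hr hy))).1
  have e : star (r * y) * (r * y) =
      ((‖x‖ ^ 2 : ℝ) : ℂ) • (star y * y) - star (x * y) * (x * y) := by
    rw [star_mul, mul_assoc, ← mul_assoc (star r), hrx, star_mul, sub_mul, mul_sub]
    simp [mul_assoc]
  have hyy := mul_mem (star_mem hy) hy
  have hxy := mul_mem hx hy
  rw [e, hτ.map_sub (A.smul_mem hyy _) (mul_mem (star_mem hxy) hxy), hτ.map_smul _ _ hyy,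
    ← hτ.norm2_sq hy, ← hτ.norm2_sq hxy, ← Complex.ofReal_mul, ← Complex.ofReal_sub,
    Complex.ofReal_re, ← mul_pow, sub_nonneg] at h
  exact le_of_sq_le_sq h (mul_nonneg (norm_nonneg _) (Real.sqrt_nonneg _))

lemma norm2_mul_le' (hτ : IsFaithfulTracialState (A : Set (H →L[ℂ] H)) τ)
    (hA : Set.centralizer (Set.centralizer (A : Set (H →L[ℂ] H))) = A)
    (hx : x ∈ A) (hy : y ∈ A) : norm2 τ (x * y) ≤ norm2 τ x * ‖y‖ := by
  have h := hτ.norm2_mul_le hA (star_mem hy) (star_mem hx)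
  rwa [← star_mul, hτ.norm2_star (mul_mem hx hy), hτ.norm2_star hx, norm_star, mul_comm] at h

lemma norm2_unitary_mul {v : H →L[ℂ] H} (hv : IsUnitary v) : norm2 τ (v * x) = norm2 τ x := by
  rw [norm2, norm2, star_mul, mul_assoc, ← mul_assoc (star v), hv.1, one_mul]

lemma norm2_mul_unitary (hτ : IsFaithfulTracialState (A : Set (H →L[ℂ] H)) τ)
    {v : H →L[ℂ] H} (hvA : v ∈ A) (hv : IsUnitary v) (hx : x ∈ A) :
    norm2 τ (x * v) = norm2 τ x := by
  have hv' : IsUnitary (star v) := by simpa [IsUnitary] using hv.symm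
  rw [← hτ.norm2_star (mul_mem hx hvA), star_mul, norm2_unitary_mul hv', hτ.norm2_star hx]

/-- Subtracting an element orthogonal to `x` does not decrease the 2-norm. -/
lemma norm2_le_norm2_sub (hτ : IsFaithfulTracialState (A : Set (H →L[ℂ] H)) τ)
    (hx : x ∈ A) (hy : y ∈ A) (h : τ (star y * x) = 0) : norm2 τ x ≤ norm2 τ (x - y) := by
  have hxx := mul_mem (star_mem hx) hx
  have hyy := mul_mem (star_mem hy) hy
  have hyx := mul_mem (star_mem hy) hx
  have hxy := mul_mem (star_mem hx) hy
  have h' : τ (star x * y) = 0 := by rw [← hτ.conj_star_mul hx hy, h, _root_.map_zero]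
  have e : star (x - y) * (x - y) =
      (star x * x + star y * y) - (star x * y + star y * x) := by
    rw [star_sub]; noncomm_ring
  refine Real.sqrt_le_sqrt ?_
  rw [e, hτ.map_sub (add_mem hxx hyy) (add_mem hxy hyx), hτ.map_add _ hxx _ hyy,
    hτ.map_add _ hxy _ hyx, h, h']
  simpa using (Complex.nonneg_iff.1 (hτ.nonneg y hy)).1

/-- If `τ (x x*) = τ (z x*)`, then `x` is no longer than `z` in 2-norm. -/
lemma norm2_le_of_mul_star (hτ : IsFaithfulTracialState (A : Set (H →L[ℂ] H)) τ)
    (hx : x ∈ A) (hz : z ∈ A) (h : τ (x * star x) = τ (z * star x)) :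
    norm2 τ x ≤ norm2 τ z := by
  have h1 := hτ.norm_le_norm2_mul_norm2 hx hz
  rw [hτ.tracial _ (star_mem hx) _ hz, ← h, hτ.tracial _ hx _ (star_mem hx), ← hτ.norm2_sq hx,
    Complex.norm_real, Real.norm_of_nonneg (sq_nonneg _), sq] at h1
  have hx0 : 0 ≤ norm2 τ x := Real.sqrt_nonneg _
  rcases hx0.eq_or_lt with h0 | h0
  · rw [← h0]; exact Real.sqrt_nonneg _
  · exact le_of_mul_le_mul_left h1 h0

end IsFaithfulTracialState

/-- `vNgen S` as a star subalgebra. -/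
def vNgenSubalgebra (S : Set (H →L[ℂ] H)) : StarSubalgebra ℂ (H →L[ℂ] H) :=
  StarSubalgebra.centralizer ℂ (StarSubalgebra.centralizer ℂ S : Set (H →L[ℂ] H))

lemma coe_vNgenSubalgebra (S : Set (H →L[ℂ] H)) :
    (vNgenSubalgebra S : Set (H →L[ℂ] H)) = vNgen S := by
  rw [vNgenSubalgebra, StarSubalgebra.coe_centralizer_centralizer, vNgen, Set.image_star]

lemma subset_vNgen (S : Set (H →L[ℂ] H)) : S ⊆ vNgen S :=
  Set.subset_union_left.trans Set.subset_centralizer_centralizer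

lemma vNgen_mono {S T : Set (H →L[ℂ] H)} (h : S ⊆ T) : vNgen S ⊆ vNgen T :=
  Set.centralizer_subset (Set.centralizer_subset
    (Set.union_subset_union h (Set.image_mono h)))

lemma mem_of_mem_span_image {G : Type*} {A : StarSubalgebra ℂ (H →L[ℂ] H)}
    {u : G → (H →L[ℂ] H)} (huA : ∀ g, u g ∈ A) (S : Set G) {x : H →L[ℂ] H}
    (hx : x ∈ Submodule.span ℂ (u '' S)) : x ∈ A := by
  have : Submodule.span ℂ (u '' S) ≤ A.toSubalgebra.toSubmodule := by
    rw [Submodule.span_le]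
    rintro _ ⟨g, -, rfl⟩
    exact huA g
  exact this hx

lemma exists_finset_mem_span_image {G E : Type*} [AddCommGroup E] [Module ℂ E]
    {u : G → E} {S : Set G} {x : E} (hx : x ∈ Submodule.span ℂ (u '' S)) :
    ∃ T : Finset G, (T : Set G) ⊆ S ∧ x ∈ Submodule.span ℂ (u '' (T : Set G)) := by
  obtain ⟨T, hT, hxT⟩ := Submodule.mem_span_finite_of_mem_span hx
  classical
  obtain ⟨T', hT', rfl⟩ := Finset.subset_set_image_iff.1 hT
  exact ⟨T', hT', by simpa using hxT⟩

lemma sum_smul_mem_span_image {G E : Type*} [AddCommGroup E] [Module ℂ E]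
    {u : G → E} {S : Set G} {n : ℕ} (c : Fin n → ℂ) (g : Fin n → G)
    (hg : ∀ i, g i ∈ S) : ∑ i, c i • u (g i) ∈ Submodule.span ℂ (u '' S) :=
  Submodule.sum_mem _ fun i _ => Submodule.smul_mem _ _ (Submodule.subset_span ⟨g i, hg i, rfl⟩)

section GroupUnitaries

variable {G : Type*} [Group G] {A : StarSubalgebra ℂ (H →L[ℂ] H)} {τ : (H →L[ℂ] H) → ℂ}
  {u : G → (H →L[ℂ] H)}

/-- Linear combinations of `u g`, `g ∉ K`, are orthogonal to `u k`, `k ∈ K`. -/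
lemma trace_mul_group_unitary_eq_zero (hτ : IsFaithfulTracialState (A : Set (H →L[ℂ] H)) τ)
    (humul : ∀ g h : G, u (g * h) = u g * u h) (huA : ∀ g, u g ∈ A)
    (htau0 : ∀ g : G, g ≠ 1 → τ (u g) = 0) (K : Subgroup G) {w q : H →L[ℂ] H}
    (hw : w ∈ Submodule.span ℂ (u '' (K : Set G)ᶜ))
    (hq : q ∈ Submodule.span ℂ (u '' (K : Set G))) : τ (w * q) = 0 := by
  have h : ∀ v ∈ Submodule.span ℂ (u '' {g | g ≠ 1}), τ v = 0 := by
    intro v hv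
    induction hv using Submodule.span_induction with
    | mem x hx => obtain ⟨g, hg, rfl⟩ := hx; exact htau0 g hg
    | zero => exact hτ.map_zero
    | add x y hx hy hx' hy' =>
      rw [hτ.map_add _ (mem_of_mem_span_image huA _ hx) _ (mem_of_mem_span_image huA _ hy),
        hx', hy', add_zero]
    | smul c x hx hx' => rw [hτ.map_smul _ _ (mem_of_mem_span_image huA _ hx), hx', mul_zero]
  refine h _ ?_
  have hwq := Submodule.mul_mem_mul hw hq
  rw [Submodule.span_mul_span] at hwq
  refine Submodule.span_mono ?_ hwq
  rintro _ ⟨_, ⟨g, hg, rfl⟩, _, ⟨k, hk, rfl⟩, rfl⟩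
  refine ⟨g * k, fun h => hg ?_, humul g k⟩
  rw [eq_inv_of_mul_eq_one_left h]
  exact K.inv_mem hk

/-- Linear combinations of `u g`, `g ∉ K`, are orthogonal to the 2-norm closure of the span of
`u k`, `k ∈ K`. -/
lemma trace_mul_eq_zero_of_dense (hτ : IsFaithfulTracialState (A : Set (H →L[ℂ] H)) τ)
    (humul : ∀ g h : G, u (g * h) = u g * u h) (huA : ∀ g, u g ∈ A)
    (htau0 : ∀ g : G, g ≠ 1 → τ (u g) = 0) (K : Subgroup G) {w q : H →L[ℂ] H}
    (hw : w ∈ Submodule.span ℂ (u '' (K : Set G)ᶜ)) (hq : q ∈ A)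
    (hdense : ∀ ε : ℝ, 0 < ε → ∃ y ∈ Submodule.span ℂ (u '' (K : Set G)), norm2 τ (q - y) < ε) :
    τ (w * q) = 0 := by
  have hwA := mem_of_mem_span_image huA _ hw
  have hb : ∀ ε : ℝ, 0 < ε → ‖τ (w * q)‖ ≤ norm2 τ (star w) * ε := by
    intro ε hε
    obtain ⟨y, hy, hyq⟩ := hdense ε hε
    have hyA := mem_of_mem_span_image huA _ hy
    have h := hτ.norm_le_norm2_mul_norm2 (star_mem hwA) (sub_mem hq hyA)
    rw [star_star, mul_sub, hτ.map_sub (mul_mem hwA hq) (mul_mem hwA hyA),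
      trace_mul_group_unitary_eq_zero hτ humul huA htau0 K hw hy, sub_zero] at h
    exact h.trans (mul_le_mul_of_nonneg_left hyq.le (Real.sqrt_nonneg _))
  by_contra hne
  have hpos : 0 < ‖τ (w * q)‖ := norm_pos_iff.2 hne
  have hs : 0 ≤ norm2 τ (star w) := Real.sqrt_nonneg _
  have h := hb (‖τ (w * q)‖ / (norm2 τ (star w) + 1)) (by positivity)
  rw [mul_div_assoc', le_div_iff₀ (by positivity)] at h
  nlinarith

/-- An element orthogonal to `u k`, `k ∈ K`, is approximated in 2-norm by linear combinations of
`u g`, `g ∉ K`. -/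
lemma exists_span_compl_norm2_lt (hτ : IsFaithfulTracialState (A : Set (H →L[ℂ] H)) τ)
    (humul : ∀ g h : G, u (g * h) = u g * u h) (huA : ∀ g, u g ∈ A)
    (hustar : ∀ g : G, star (u g) = u g⁻¹)
    (htau0 : ∀ g : G, g ≠ 1 → τ (u g) = 0) (K : Subgroup G) {a : H →L[ℂ] H} (ha : a ∈ A)
    (hdense : ∀ ε : ℝ, 0 < ε → ∃ y ∈ Submodule.span ℂ (Set.range u), norm2 τ (a - y) < ε)
    (horth : ∀ y ∈ Submodule.span ℂ (u '' (K : Set G)), τ (a * y) = 0) {ε : ℝ} (hε : 0 < ε) :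
    ∃ c ∈ Submodule.span ℂ (u '' (K : Set G)ᶜ), norm2 τ (a - c) < ε := by
  obtain ⟨y, hy, hya⟩ := hdense ε hε
  rw [← Set.image_univ, ← Set.union_compl_self (K : Set G), Set.image_union,
    Submodule.span_union, Submodule.mem_sup] at hy
  obtain ⟨b, hb, c, hc, rfl⟩ := hy
  refine ⟨c, hc, lt_of_le_of_lt ?_ hya⟩
  have hbA := mem_of_mem_span_image huA _ hb
  have hcA := mem_of_mem_span_image huA _ hc
  have hbs : star b ∈ Submodule.span ℂ (u '' (K : Set G)) := by
    clear hya hbA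
    induction hb using Submodule.span_induction with
    | mem x hx =>
      obtain ⟨k, hk, rfl⟩ := hx
      exact Submodule.subset_span ⟨k⁻¹, K.inv_mem hk, (hustar k).symm⟩
    | zero => simp
    | add x y _ _ hx hy => rw [star_add]; exact add_mem hx hy
    | smul c x _ hx => rw [star_smul]; exact Submodule.smul_mem _ _ hx
  have hsub : a - (b + c) = (a - c) - b := by abel
  rw [hsub]
  refine hτ.norm2_le_norm2_sub (sub_mem ha hcA) hbA ?_
  rw [mul_sub, hτ.map_sub (mul_mem (star_mem hbA) ha) (mul_mem (star_mem hbA) hcA),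
    hτ.tracial _ (star_mem hbA) _ ha, hτ.tracial _ (star_mem hbA) _ hcA, horth _ hbs,
    trace_mul_group_unitary_eq_zero hτ humul huA htau0 K hc hbs, sub_zero]

/-- Property (P) in terms of linear combinations of group unitaries: one `f ∈ F` moves the
products `c i * u f * d j` off `F`. -/
lemma exists_mul_mul_mem_span_compl (humul : ∀ g h : G, u (g * h) = u g * u h)
    (F K : Subgroup G)
    (hP : ∀ S : Finset G, (∀ g ∈ S, g ∉ K) → ∃ f ∈ F, ∀ g ∈ S, ∀ h ∈ S, g * f * h ∉ F)
    {ι : Type*} [Fintype ι] (c d : ι → (H →L[ℂ] H))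
    (hc : ∀ i, c i ∈ Submodule.span ℂ (u '' (K : Set G)ᶜ))
    (hd : ∀ i, d i ∈ Submodule.span ℂ (u '' (K : Set G)ᶜ)) :
    ∃ f ∈ F, ∀ i j, c i * u f * d j ∈ Submodule.span ℂ (u '' (F : Set G)ᶜ) := by
  classical
  choose S hSK hcS using fun i => exists_finset_mem_span_image (hc i)
  choose T hTK hdT using fun i => exists_finset_mem_span_image (hd i)
  obtain ⟨f, hf, hfST⟩ := hP (Finset.univ.biUnion S ∪ Finset.univ.biUnion T) (by
    intro g hg
    simp only [Finset.mem_union, Finset.mem_biUnion, Finset.mem_univ, true_and] at hg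
    rcases hg with ⟨i, hi⟩ | ⟨i, hi⟩
    · exact hSK i hi
    · exact hTK i hi)
  refine ⟨f, hf, fun i j => ?_⟩
  have h := Submodule.mul_mem_mul (Submodule.mul_mem_mul (hcS i)
    (Submodule.mem_span_singleton_self (R := ℂ) (u f))) (hdT j)
  rw [Submodule.span_mul_span, Submodule.span_mul_span] at h
  refine Submodule.span_mono ?_ h
  rintro _ ⟨_, ⟨_, ⟨g, hg, rfl⟩, _, rfl, rfl⟩, _, ⟨k, hk, rfl⟩, rfl⟩
  refine ⟨g * f * k, hfST g ?_ k ?_, by simp [humul]⟩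
  · exact Finset.mem_union_left _ (Finset.mem_biUnion.2 ⟨i, Finset.mem_univ _, hg⟩)
  · exact Finset.mem_union_right _ (Finset.mem_biUnion.2 ⟨j, Finset.mem_univ _, hk⟩)

end GroupUnitaries

/-- If `d` is orthogonal to `B`, the difference of conditional expectations appearing in the
relative WAHP is bounded by the distance from `(x - EN x) v (y - EN y)` to `d`. -/
lemma norm2_condExp_sub_le {A B N : StarSubalgebra ℂ (H →L[ℂ] H)} {τ : (H →L[ℂ] H) → ℂ}
    (hτ : IsFaithfulTracialState (A : Set (H →L[ℂ] H)) τ) (hBN : B ≤ N) (hNA : N ≤ A)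
    {EB EN : (H →L[ℂ] H) → (H →L[ℂ] H)}
    (hEB : IsCondExp (A : Set (H →L[ℂ] H)) (B : Set (H →L[ℂ] H)) τ EB)
    (hEN : IsCondExp (A : Set (H →L[ℂ] H)) (N : Set (H →L[ℂ] H)) τ EN)
    {x y v d : H →L[ℂ] H} (hx : x ∈ A) (hy : y ∈ A) (hv : v ∈ B) (hd : d ∈ A)
    (hdB : ∀ b ∈ B, τ (d * b) = 0) :
    norm2 τ (EB (x * v * y) - EB (EN x * v * EN y)) ≤
      norm2 τ ((x - EN x) * v * (y - EN y) - d) := by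
  have hvN := hBN hv
  have hvA := hNA hvN
  have hnx : EN x ∈ N := hEN.1 x hx
  have hny : EN y ∈ N := hEN.1 y hy
  have hax := sub_mem hx (hNA hnx)
  have hay := sub_mem hy (hNA hny)
  have hz : x * v * y ∈ A := mul_mem (mul_mem hx hvA) hy
  have hw : EN x * v * EN y ∈ A := mul_mem (mul_mem (hNA hnx) hvA) (hNA hny)
  have hzB : EB (x * v * y) ∈ B := hEB.1 _ hz
  have hwB : EB (EN x * v * EN y) ∈ B := hEB.1 _ hw
  set p := EB (x * v * y) - EB (EN x * v * EN y)
  have hpB : p ∈ B := sub_mem hzB hwB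
  have hpN := star_mem (hBN hpB)
  have hpA := hNA hpN
  have hb : ∀ z ∈ A, τ (EB z * star p) = τ (z * star p) := by
    intro z hz
    have h := hEB.2 z hz _ (star_mem hpB)
    have hE : EB z ∈ A := hNA (hBN (hEB.1 z hz))
    rw [sub_mul, hτ.map_sub (mul_mem hz hpA) (mul_mem hE hpA)] at h
    exact (sub_eq_zero.1 h).symm
  have hc1 : τ (EN x * v * (y - EN y) * star p) = 0 := by
    have hm := mul_mem hnx hvN
    rw [mul_assoc, hτ.tracial _ (hNA hm) _ (mul_mem hay hpA), mul_assoc]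
    exact hEN.2 y hy _ (mul_mem hpN hm)
  have hc2 : τ ((x - EN x) * v * EN y * star p) = 0 := by
    rw [mul_assoc, mul_assoc]
    exact hEN.2 x hx _ (mul_mem hvN (mul_mem hny hpN))
  have hq : (x - EN x) * v * (y - EN y) ∈ A := mul_mem (mul_mem hax hvA) hay
  refine hτ.norm2_le_of_mul_star (hNA (hBN hpB)) (sub_mem hq hd) ?_
  have hm1 : EN x * v * (y - EN y) * star p ∈ A :=
    mul_mem (mul_mem (mul_mem (hNA hnx) hvA) hay) hpA
  have hm2 : (x - EN x) * v * EN y * star p ∈ A :=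
    mul_mem (mul_mem (mul_mem hax hvA) (hNA hny)) hpA
  have e : x * v * y * star p = (x - EN x) * v * (y - EN y) * star p +
      (EN x * v * (y - EN y) * star p + (x - EN x) * v * EN y * star p) +
      EN x * v * EN y * star p := by noncomm_ring
  have hqp := mul_mem hq hpA
  calc τ (p * star p) = τ (EB (x * v * y) * star p - EB (EN x * v * EN y) * star p) := by
        rw [← sub_mul]
    _ = τ (x * v * y * star p) - τ (EN x * v * EN y * star p) := by
        rw [hτ.map_sub (mul_mem (hNA (hBN hzB)) hpA) (mul_mem (hNA (hBN hwB)) hpA),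
          hb _ hz, hb _ hw]
    _ = τ ((x - EN x) * v * (y - EN y) * star p) := by
        rw [e, hτ.map_add _ (add_mem hqp (add_mem hm1 hm2)) _ (mul_mem hw hpA),
          hτ.map_add _ hqp _ (add_mem hm1 hm2), hτ.map_add _ hm1 _ hm2, hc1, hc2]
        ring
    _ = τ (((x - EN x) * v * (y - EN y) - d) * star p) := by
        rw [sub_mul (_ * _), hτ.map_sub hqp (mul_mem hd hpA), hdB _ (star_mem hpB), sub_zero]

/-- If `F ≤ H ≤ G` satisfy property (P), then the triple
`L(F) ⊆ L(H) ⊆ L(G) = M` satisfies the relative WAHP. -/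
theorem group_triple_relative_WAHP
    {H : Type*} [NormedAddCommGroup H] [InnerProductSpace ℂ H] [CompleteSpace H]
    {G : Type*} [Group G] (F Hgp : Subgroup G) (hFH : F ≤ Hgp)
    -- property (P)
    (hP : ∀ S : Finset G, (∀ g ∈ S, g ∉ Hgp) →
      ∃ f ∈ F, ∀ g ∈ S, ∀ h ∈ S, g * f * h ∉ F)
    (M : Set (H →L[ℂ] H)) (τ : (H →L[ℂ] H) → ℂ) (u : G → (H →L[ℂ] H))
    (hMvn : IsVonNeumannAlgebra M) (hτ : IsFaithfulTracialState M τ)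
    (hu1 : u 1 = 1) (humul : ∀ g h : G, u (g * h) = u g * u h)
    (hustar : ∀ g : G, star (u g) = u g⁻¹)
    (huM : ∀ g : G, u g ∈ M) (huU : ∀ g : G, IsUnitary (u g))
    (htau0 : ∀ g : G, g ≠ 1 → τ (u g) = 0)
    (hgen : M = vNgen (Set.range u))
    -- `‖·‖₂`-density of finite linear combinations of group unitaries
    (hdenseM : ∀ x ∈ M, ∀ ε : ℝ, 0 < ε → ∃ (n : ℕ) (c : Fin n → ℂ) (g : Fin n → G),
      norm2 τ (x - ∑ i, c i • u (g i)) < ε)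
    (hdenseH : ∀ x ∈ vNgen (u '' (Hgp : Set G)), ∀ ε : ℝ, 0 < ε →
      ∃ (n : ℕ) (c : Fin n → ℂ) (g : Fin n → G), (∀ i, g i ∈ Hgp) ∧
        norm2 τ (x - ∑ i, c i • u (g i)) < ε)
    (hdenseF : ∀ x ∈ vNgen (u '' (F : Set G)), ∀ ε : ℝ, 0 < ε →
      ∃ (n : ℕ) (c : Fin n → ℂ) (g : Fin n → G), (∀ i, g i ∈ F) ∧
        norm2 τ (x - ∑ i, c i • u (g i)) < ε)
    (EF EH : (H →L[ℂ] H) → (H →L[ℂ] H))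
    (hEF : IsCondExp M (vNgen (u '' (F : Set G))) τ EF)
    (hEH : IsCondExp M (vNgen (u '' (Hgp : Set G))) τ EH) :
    RelWAHP M (vNgen (u '' (Hgp : Set G))) (vNgen (u '' (F : Set G))) τ EF EH := by
  obtain ⟨A, rfl⟩ : ∃ A : StarSubalgebra ℂ (H →L[ℂ] H), (A : Set (H →L[ℂ] H)) = M :=
    ⟨vNgenSubalgebra (Set.range u), by rw [hgen, coe_vNgenSubalgebra]⟩
  set B := vNgenSubalgebra (u '' (F : Set G))
  set N := vNgenSubalgebra (u '' (Hgp : Set G))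
  have hB : vNgen (u '' (F : Set G)) = B := (coe_vNgenSubalgebra _).symm
  have hN : vNgen (u '' (Hgp : Set G)) = N := (coe_vNgenSubalgebra _).symm
  have hBN : B ≤ N := by
    rw [← SetLike.coe_subset_coe, ← hB, ← hN]
    exact vNgen_mono (Set.image_mono hFH)
  have hNA : N ≤ A := by
    rw [← SetLike.coe_subset_coe, hgen, ← hN]
    exact vNgen_mono (Set.image_subset_range _ _)
  have huB : ∀ f ∈ F, u f ∈ B := fun f hf => by
    rw [← SetLike.mem_coe, ← hB]; exact subset_vNgen _ ⟨f, hf, rfl⟩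
  have hspanN : ∀ y ∈ Submodule.span ℂ (u '' (Hgp : Set G)), y ∈ N := by
    have : Submodule.span ℂ (u '' (Hgp : Set G)) ≤ N.toSubalgebra.toSubmodule := by
      rw [Submodule.span_le]
      exact (subset_vNgen _).trans hN.subset
    exact this
  rw [hB] at hEF hdenseF
  rw [hN] at hEH
  rw [hB, hN]
  intro n x hx ε hε
  set a : Fin n → (H →L[ℂ] H) := fun i => x i - EH (x i)
  have ha : ∀ i, a i ∈ A := fun i => sub_mem (hx i) (hNA (hEH.1 _ (hx i)))
  have happrox : ∀ i, ∀ δ : ℝ, 0 < δ →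
      ∃ c ∈ Submodule.span ℂ (u '' (Hgp : Set G)ᶜ), norm2 τ (a i - c) < δ := by
    intro i δ hδ
    refine exists_span_compl_norm2_lt hτ humul huM hustar htau0 Hgp (ha i) ?_
      (fun y hy => hEH.2 _ (hx i) y (hspanN y hy)) hδ
    intro η hη
    obtain ⟨m, c, g, h⟩ := hdenseM _ (ha i) η hη
    refine ⟨_, ?_, h⟩
    rw [← Set.image_univ]
    exact sum_smul_mem_span_image c g fun _ => Set.mem_univ _
  have hbound : ∀ b : Fin n → (H →L[ℂ] H), ∃ C : ℝ, 0 < C ∧ ∀ i, ‖b i‖ ≤ C := fun b =>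
    ⟨∑ i, ‖b i‖ + 1, by positivity, fun i =>
      (Finset.single_le_sum (f := fun i => ‖b i‖) (fun _ _ => norm_nonneg _)
        (Finset.mem_univ i)).trans (by linarith)⟩
  obtain ⟨C, hC, haC⟩ := hbound a
  choose c hc hca using fun i => happrox i (ε / 2 / C) (by positivity)
  obtain ⟨D, hD, hcD⟩ := hbound c
  choose d hd hda using fun i => happrox i (ε / 2 / D) (by positivity)
  obtain ⟨f, hf, hfF⟩ := exists_mul_mul_mem_span_compl humul F Hgp hP d c hd hc
  refine ⟨u f, huB f hf, huU f, fun i j => ?_⟩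
  have hcA := mem_of_mem_span_image huM _ (hc j)
  have hdcA := mem_of_mem_span_image huM _ (hfF i j)
  have horth : ∀ b ∈ B, τ (d i * u f * c j * b) = 0 := fun b hb => by
    refine trace_mul_eq_zero_of_dense hτ humul huM htau0 F (hfF i j) (hNA (hBN hb)) ?_
    intro η hη
    obtain ⟨m, k, g, hg, h⟩ := hdenseF b hb η hη
    exact ⟨_, sum_smul_mem_span_image k g hg, h⟩
  refine (norm2_condExp_sub_le hτ hBN hNA hEF hEH (hx i) (hx j) (huB f hf) hdcA horth).trans_lt ?_
  have hac := sub_mem (ha j) hcA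
  have had := sub_mem (ha i) (mem_of_mem_span_image huM _ (hd i))
  have hA := hMvn.double_commutant
  have e : (x i - EH (x i)) * u f * (x j - EH (x j)) - d i * u f * c j =
      a i * (u f * (a j - c j)) + (a i - d i) * u f * c j := by
    change a i * u f * a j - _ = _
    noncomm_ring
  rw [e]
  have h1 : norm2 τ (a i * (u f * (a j - c j))) < ε / 2 := by
    refine (hτ.norm2_mul_le hA (ha i) (mul_mem (huM f) hac)).trans_lt ?_
    rw [IsFaithfulTracialState.norm2_unitary_mul (huU f)]
    refine (mul_le_mul_of_nonneg_right (haC i) (Real.sqrt_nonneg _)).trans_lt ?_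
    rw [mul_comm]
    exact (lt_div_iff₀ hC).1 (hca j)
  have h2 : norm2 τ ((a i - d i) * u f * c j) < ε / 2 := by
    refine (hτ.norm2_mul_le' hA (mul_mem had (huM f)) hcA).trans_lt ?_
    rw [hτ.norm2_mul_unitary (huM f) (huU f) had]
    refine (mul_le_mul_of_nonneg_left (hcD j) (Real.sqrt_nonneg _)).trans_lt ?_
    exact (lt_div_iff₀ hD).1 (hda i)
  have h3 := hτ.norm2_add_le (mul_mem (ha i) (mul_mem (huM f) hac))
    (mul_mem (mul_mem had (huM f)) hcA)
  linarith
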